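/- arXiv:2008.07846 — 4 statements merged into one kernel-verified Lean document; each statement's English description precedes it below -/
import Mathlib

section
/- Let (Ĝ, π) be a C₂-graded finite group and let (V, (B_w)) be an irreducible H-representation of (Ĝ, π) in which every simple ℂG-submodule W satisfies W ⊆ W^⊥, where W^⊥ := {v ∈ V : B_w(u, v) = 0 for all u ∈ W} for some (equivalently, every) odd w. Then for every simple ℂG-submodule W there is a simple ℂG-submodule W' with V = W ⊕ W' as ℂG-modules and W^⊥ = W; moreover W is NOT isomorphic to W' as a ℂG-module, and the group Aut_H(V) of H-automorphisms of V is isomorphic, as a group, to ℂˣ. -/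
open scoped ComplexConjugate

noncomputable section Defs

variable {Ghat : Type} [Group Ghat]

/-- Conjugate `g ∈ G = ker π` by an arbitrary element `w` of the graded group. -/
def conjKer (π : Ghat →* ℤˣ) (w : Ghat) (g : π.ker) : π.ker :=
  ⟨w * (g : Ghat) * w⁻¹, by
    have hg : π (g : Ghat) = 1 := g.2
    simp [MonoidHom.mem_ker, map_mul, map_inv, hg]⟩

/-- The square `w²` of any element lies in `G = ker π`. -/
def sqKer (π : Ghat →* ℤˣ) (w : Ghat) : π.ker :=
  ⟨w * w, by simp [MonoidHom.mem_ker, map_mul, Int.units_mul_self]⟩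

/-- For odd `w₁, w₂`, the element `w₂ w₁⁻¹` lies in `G = ker π`. -/
def ratioKer (π : Ghat →* ℤˣ) (w₂ w₁ : Ghat) (h₂ : π w₂ = -1) (h₁ : π w₁ = -1) : π.ker :=
  ⟨w₂ * w₁⁻¹, by simp [MonoidHom.mem_ker, map_mul, map_inv, h₁, h₂]⟩

/-- A family of forms `B w` (for odd `w`) making the `G`-representation `ρ` into a
hermitian `K`-representation of the `C₂`-graded group `(Ghat, π)` with respect to the
ring involution `ι` of `K`:  each `B w` is `ι`-sesquilinear, nondegenerate, `w`-invariant,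
`w`-hermitian, and the various forms are compatible. -/
structure IsHermRep (K : Type) [Field K] (ι : K →+* K) (π : Ghat →* ℤˣ)
    {V : Type} [AddCommGroup V] [Module K V]
    (ρ : Representation K π.ker V) (B : Ghat → V → V → K) : Prop where
  add_left : ∀ w, π w = -1 → ∀ u u' v : V, B w (u + u') v = B w u v + B w u' v
  smul_left : ∀ w, π w = -1 → ∀ (a : K) (u v : V), B w (a • u) v = ι a * B w u v
  add_right : ∀ w, π w = -1 → ∀ u v v' : V, B w u (v + v') = B w u v + B w u v'
  smul_right : ∀ w, π w = -1 → ∀ (a : K) (u v : V), B w u (a • v) = a * B w u v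
  nondeg_left : ∀ w, π w = -1 → ∀ u : V, (∀ v, B w u v = 0) → u = 0
  nondeg_right : ∀ w, π w = -1 → ∀ v : V, (∀ u, B w u v = 0) → v = 0
  invariant : ∀ w, π w = -1 → ∀ (g : π.ker) (u v : V),
      B w (ρ g u) (ρ (conjKer π w g) v) = B w u v
  hermitian : ∀ w, π w = -1 → ∀ u v : V, B w u (ρ (sqKer π w) v) = ι (B w v u)
  compat : ∀ w₁ w₂ (h₁ : π w₁ = -1) (h₂ : π w₂ = -1) (u v : V),
      B w₁ u v = B w₂ u (ρ (ratioKer π w₂ w₁ h₂ h₁) v)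

/-- The right orthogonal complement of `W` with respect to the form `B w`. -/
def perp {K : Type} [Field K] {V : Type} [AddCommGroup V] [Module K V]
    (B : Ghat → V → V → K) (W : Submodule K V) (w : Ghat) : Set V :=
  {v : V | ∀ u ∈ W, B w u v = 0}

/-- `W` is a subrepresentation: a `G`-invariant subspace on which every restricted
form is nondegenerate. -/
def IsSubrep (K : Type) [Field K] (π : Ghat →* ℤˣ)
    {V : Type} [AddCommGroup V] [Module K V]
    (ρ : Representation K π.ker V) (B : Ghat → V → V → K) (W : Submodule K V) : Prop :=
  (∀ (g : π.ker), ∀ v ∈ W, ρ g v ∈ W) ∧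
  ∀ w, π w = -1 →
    (∀ u ∈ W, (∀ v ∈ W, B w u v = 0) → u = 0) ∧
    (∀ v ∈ W, (∀ u ∈ W, B w u v = 0) → v = 0)

/-- The hermitian representation `(V, B)` is irreducible. -/
def IsIrredRep (K : Type) [Field K] (π : Ghat →* ℤˣ)
    {V : Type} [AddCommGroup V] [Module K V]
    (ρ : Representation K π.ker V) (B : Ghat → V → V → K) : Prop :=
  (∃ v : V, v ≠ 0) ∧ ∀ W : Submodule K V, IsSubrep K π ρ B W → W = ⊥ ∨ W = ⊤

/-- `W` is an irreducible subrepresentation. -/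
def IsIrredSubrep (K : Type) [Field K] (π : Ghat →* ℤˣ)
    {V : Type} [AddCommGroup V] [Module K V]
    (ρ : Representation K π.ker V) (B : Ghat → V → V → K) (W : Submodule K V) : Prop :=
  IsSubrep K π ρ B W ∧ W ≠ ⊥ ∧
    ∀ U : Submodule K V, U ≤ W → IsSubrep K π ρ B U → U = ⊥ ∨ U = W

/-- `W` is a `G`-invariant subspace that is simple as a `KG`-module. -/
def IsSimpleGSub (K : Type) [Field K] (π : Ghat →* ℤˣ)
    {V : Type} [AddCommGroup V] [Module K V]
    (ρ : Representation K π.ker V) (W : Submodule K V) : Prop :=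
  (∀ (g : π.ker), ∀ v ∈ W, ρ g v ∈ W) ∧ W ≠ ⊥ ∧
    ∀ U : Submodule K V, U ≤ W → (∀ (g : π.ker), ∀ v ∈ U, ρ g v ∈ U) → U = ⊥ ∨ U = W

/-- The group of automorphisms of a hermitian representation: the `G`-equivariant linear
automorphisms preserving every form `B w`. -/
def AutRep (K : Type) [Field K] (π : Ghat →* ℤˣ)
    {V : Type} [AddCommGroup V] [Module K V]
    (ρ : Representation K π.ker V) (B : Ghat → V → V → K) : Subgroup (V ≃ₗ[K] V) where
  carrier := {f | (∀ (g : π.ker) (v : V), f (ρ g v) = ρ g (f v)) ∧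
      ∀ w, π w = -1 → ∀ u v : V, B w (f u) (f v) = B w u v}
  one_mem' := ⟨fun _ _ => rfl, fun _ _ _ _ => rfl⟩
  mul_mem' := by
    rintro f g ⟨hf1, hf2⟩ ⟨hg1, hg2⟩
    refine ⟨fun a v => ?_, fun w hw u v => ?_⟩
    · show f (g (ρ a v)) = ρ a (f (g v))
      rw [hg1, hf1]
    · show B w (f (g u)) (f (g v)) = B w u v
      rw [hf2 w hw, hg2 w hw]
  inv_mem' := by
    rintro f ⟨hf1, hf2⟩
    refine ⟨fun g v => ?_, fun w hw u v => ?_⟩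
    · apply f.injective
      show f (f.symm (ρ g v)) = f (ρ g (f.symm v))
      rw [f.apply_symm_apply, hf1, f.apply_symm_apply]
    · show B w (f.symm u) (f.symm v) = B w u v
      conv_rhs => rw [← f.apply_symm_apply u, ← f.apply_symm_apply v]
      exact (hf2 w hw _ _).symm

/-- Linear (`L`-) representations: the hermitian theory over `ℂ` with the trivial involution. -/
abbrev IsLRep (π : Ghat →* ℤˣ) {V : Type} [AddCommGroup V] [Module ℂ V]
    (ρ : Representation ℂ π.ker V) (B : Ghat → V → V → ℂ) : Prop :=
  IsHermRep ℂ (RingHom.id ℂ) π ρ B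

/-- Hermitian (`H`-) representations: the hermitian theory over `ℂ` with complex conjugation. -/
abbrev IsHRep (π : Ghat →* ℤˣ) {V : Type} [AddCommGroup V] [Module ℂ V]
    (ρ : Representation ℂ π.ker V) (B : Ghat → V → V → ℂ) : Prop :=
  IsHermRep ℂ (starRingEnd ℂ) π ρ B

/-- An antilinear (`A`-) representation of the `C₂`-graded group `(Ghat, π)`: an action of the
whole group `Ghat` by additive automorphisms in which even elements act `ℂ`-linearly and odd
elements act conjugate-linearly. -/
structure IsARep (π : Ghat →* ℤˣ) {V : Type} [AddCommGroup V] [Module ℂ V]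
    (a : Ghat → V → V) : Prop where
  map_add : ∀ (z : Ghat) (u v : V), a z (u + v) = a z u + a z v
  map_smul_even : ∀ z, π z = 1 → ∀ (c : ℂ) (v : V), a z (c • v) = c • a z v
  map_smul_odd : ∀ z, π z = -1 → ∀ (c : ℂ) (v : V), a z (c • v) = (starRingEnd ℂ c) • a z v
  map_one : ∀ v : V, a 1 v = v
  map_mul : ∀ (z₁ z₂ : Ghat) (v : V), a (z₁ * z₂) v = a z₁ (a z₂ v)

/-- The componentwise action of `G` on the direct sum `V^{⊕n}`. -/
def piRep (π : Ghat →* ℤˣ) {V : Type} [AddCommGroup V] [Module ℂ V]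
    (ρ : Representation ℂ π.ker V) (n : ℕ) : Representation ℂ π.ker (Fin n → V) where
  toFun g := LinearMap.pi fun i => (ρ g) ∘ₗ LinearMap.proj i
  map_one' := by
    ext v i
    simp
  map_mul' g h := by
    ext v i
    simp

/-- The orthogonal sum of the forms `B w` on the direct sum `V^{⊕n}`. -/
def sumForm {V : Type} [AddCommGroup V] [Module ℂ V]
    (B : Ghat → V → V → ℂ) (n : ℕ) : Ghat → (Fin n → V) → (Fin n → V) → ℂ :=
  fun w u v => ∑ i, B w (u i) (v i)

/-- The bilinear forms `B_w(u,v) = ⟨u, w⁻¹·v⟩ + ⟨v, w·u⟩` associated with an invariant inner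
product on an `A`-representation. -/
def assocForm {V : Type} [AddCommGroup V] [Module ℂ V]
    (a : Ghat → V → V) (h : V → V → ℂ) : Ghat → V → V → ℂ :=
  fun w u v => h u (a w⁻¹ v) + h v (a w u)

end Defs

section SimpleSubmodules

variable {Ghat : Type} [Group Ghat] {K : Type} [Field K] {π : Ghat →* ℤˣ}
  {V : Type} [AddCommGroup V] [Module K V] {ρ : Representation K π.ker V}

/-- Every nonzero invariant subspace contains a simple one. -/
lemma exists_isSimpleGSub_le [FiniteDimensional K V] {C : Submodule K V}
    (hC : ∀ g, ∀ v ∈ C, ρ g v ∈ C) (hne : C ≠ ⊥) : ∃ U ≤ C, IsSimpleGSub K π ρ U := by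
  obtain ⟨U, ⟨hUC, hU, hU0⟩, hmin⟩ := wellFounded_lt.has_min
    {U : Submodule K V | U ≤ C ∧ (∀ g, ∀ v ∈ U, ρ g v ∈ U) ∧ U ≠ ⊥} ⟨C, le_rfl, hC, hne⟩
  refine ⟨U, hUC, hU, hU0, fun X hXU hX => or_iff_not_imp_left.2 fun hX0 => ?_⟩
  by_contra hXne
  exact hmin X ⟨hXU.trans hUC, hX, hX0⟩ (lt_of_le_of_ne hXU hXne)

lemma IsSimpleGSub.inf_eq_bot_or_le {W U : Submodule K V} (hW : IsSimpleGSub K π ρ W)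
    (hU : ∀ g, ∀ v ∈ U, ρ g v ∈ U) : W ⊓ U = ⊥ ∨ W ≤ U := by
  rcases hW.2.2 (W ⊓ U) inf_le_left (fun g v hv => ⟨hW.1 g v hv.1, hU g v hv.2⟩) with h | h
  · exact Or.inl h
  · exact Or.inr (inf_eq_left.1 h)

lemma IsSimpleGSub.exists_ne_zero {W : Submodule K V} (hW : IsSimpleGSub K π ρ W) :
    ∃ v ∈ W, v ≠ 0 :=
  (Submodule.ne_bot_iff W).1 hW.2.1

/-- **Schur's lemma**: an equivariant endomorphism preserving a simple subspace acts on it by a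
scalar. -/
lemma IsSimpleGSub.exists_eq_smul [IsAlgClosed K] [FiniteDimensional K V] {W : Submodule K V}
    (hW : IsSimpleGSub K π ρ W) {f : V →ₗ[K] V} (hf : ∀ g v, f (ρ g v) = ρ g (f v))
    (hfW : ∀ v ∈ W, f v ∈ W) : ∃ c : K, ∀ v ∈ W, f v = c • v := by
  have : Nontrivial W := (Submodule.nontrivial_iff_ne_bot).2 hW.2.1
  obtain ⟨c, hc⟩ := Module.End.exists_eigenvalue (f.restrict hfW)
  obtain ⟨x, hx, hx0⟩ := hc.exists_hasEigenvector
  have hxc : f x = c • (x : V) := congrArg Subtype.val (Module.End.mem_eigenspace_iff.1 hx)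
  rcases hW.inf_eq_bot_or_le (U := Module.End.eigenspace f c) (fun g v hv => by
    rw [Module.End.mem_eigenspace_iff] at hv ⊢
    rw [hf, hv, map_smul]) with h | h
  · exact absurd (Subtype.ext ((Submodule.eq_bot_iff _).1 h x
      ⟨x.2, Module.End.mem_eigenspace_iff.2 hxc⟩)) hx0
  · exact ⟨c, fun v hv => Module.End.mem_eigenspace_iff.1 (h hv)⟩

lemma projection_map_rho {W W' : Submodule K V} (hc : IsCompl W W')
    (hW : ∀ g, ∀ v ∈ W, ρ g v ∈ W) (hW' : ∀ g, ∀ v ∈ W', ρ g v ∈ W') (g : π.ker) (v : V) :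
    W.projection W' hc (ρ g v) = ρ g (W.projection W' hc v) := by
  obtain ⟨a, ha, b, hb, rfl⟩ := Submodule.mem_sup.1 (hc.sup_eq_top ▸ Submodule.mem_top : v ∈ W ⊔ W')
  have h1 : ∀ x ∈ W, W.projection W' hc x = x := fun x hx =>
    Submodule.projection_apply_left hc ⟨x, hx⟩
  have h2 : ∀ x ∈ W', W.projection W' hc x = 0 := fun x hx =>
    (Submodule.projection_apply_eq_zero_iff hc).2 hx
  simp only [map_add, h1 a ha, h2 b hb, h1 _ (hW g a ha), h2 _ (hW' g b hb), map_zero]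

/-- An equivariant endomorphism preserves each of two complementary nonisomorphic simple
subspaces. -/
lemma IsSimpleGSub.map_mem_of_not_iso {W W' : Submodule K V}
    (hW : IsSimpleGSub K π ρ W) (hW' : IsSimpleGSub K π ρ W') (hc : IsCompl W W')
    (hiso : ¬ ∃ f : V →ₗ[K] V, Set.InjOn f W ∧ Submodule.map f W = W' ∧
      ∀ (g : π.ker), ∀ u ∈ W, f (ρ g u) = ρ g (f u))
    {f : V →ₗ[K] V} (hf : ∀ g v, f (ρ g v) = ρ g (f v)) : ∀ v ∈ W, f v ∈ W := by
  set p := W'.projection W hc.symm ∘ₗ f with hp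
  have hpρ : ∀ g v, p (ρ g v) = ρ g (p v) := fun g v => by
    simp only [hp, LinearMap.comp_apply, hf, projection_map_rho hc.symm hW'.1 hW.1]
  rcases hW.inf_eq_bot_or_le (U := LinearMap.ker p) (fun g v hv => by
    rw [LinearMap.mem_ker] at hv ⊢
    rw [hpρ, hv, map_zero]) with h | h
  · have hinj : Set.InjOn p W := fun x hx y hy hxy => sub_eq_zero.1
      ((Submodule.eq_bot_iff _).1 h (x - y) ⟨W.sub_mem hx hy,
        LinearMap.mem_ker.2 (by rw [map_sub, hxy, sub_self])⟩)
    refine absurd ⟨p, hinj, ?_, fun g u _ => hpρ g u⟩ hiso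
    refine (hW'.2.2 (W.map p) ?_ ?_).resolve_left fun h0 => ?_
    · rintro _ ⟨x, -, rfl⟩
      exact Submodule.projection_apply_mem hc.symm _
    · rintro g _ ⟨x, hx, rfl⟩
      exact ⟨ρ g x, hW.1 g x hx, hpρ g x⟩
    · obtain ⟨x, hx, hx0⟩ := hW.exists_ne_zero
      refine hx0 (hinj hx W.zero_mem ?_)
      rw [map_zero]
      exact (Submodule.eq_bot_iff _).1 h0 _ ⟨x, hx, rfl⟩
  · exact fun v hv => (Submodule.projection_apply_eq_zero_iff hc.symm).1 (h hv)

end SimpleSubmodules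

section Forms

variable {Ghat : Type} [Group Ghat] {K : Type} [Field K] {ι : K →+* K} {π : Ghat →* ℤˣ}
  {V : Type} [AddCommGroup V] [Module K V] {ρ : Representation K π.ker V}
  {B : Ghat → V → V → K} {w : Ghat}

lemma rho_inv_rho (g : π.ker) (v : V) : ρ g⁻¹ (ρ g v) = v := by
  rw [← Module.End.mul_apply, ← map_mul, inv_mul_cancel, map_one, Module.End.one_apply]

lemma rho_rho_inv (g : π.ker) (v : V) : ρ g (ρ g⁻¹ v) = v := by
  rw [← Module.End.mul_apply, ← map_mul, mul_inv_cancel, map_one, Module.End.one_apply]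

namespace IsHermRep

lemma zero_left (hB : IsHermRep K ι π ρ B) (hw : π w = -1) (v : V) : B w 0 v = 0 := by
  simpa using hB.smul_left w hw 0 0 v

lemma zero_right (hB : IsHermRep K ι π ρ B) (hw : π w = -1) (u : V) : B w u 0 = 0 := by
  simpa using hB.smul_right w hw 0 u 0

lemma apply_rho_right (hB : IsHermRep K ι π ρ B) (hw : π w = -1) (g : π.ker) (u v : V) :
    B w u (ρ g v) = B w (ρ (conjKer π w⁻¹ g⁻¹) u) v := by
  have hg : conjKer π w (conjKer π w⁻¹ g⁻¹) = g⁻¹ := by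
    ext
    simp [conjKer, mul_assoc]
  rw [← hB.invariant w hw (conjKer π w⁻¹ g⁻¹) u (ρ g v), hg, rho_inv_rho]

/-- The right orthogonal complement as a subspace. -/
def perpSubmodule (hB : IsHermRep K ι π ρ B) (hw : π w = -1) (W : Submodule K V) :
    Submodule K V where
  carrier := perp B W w
  add_mem' ha hb u hu := by rw [hB.add_right w hw, ha u hu, hb u hu, add_zero]
  zero_mem' u _ := hB.zero_right hw u
  smul_mem' c v hv u hu := by rw [hB.smul_right w hw, hv u hu, mul_zero]

lemma rho_mem_perpSubmodule (hB : IsHermRep K ι π ρ B) (hw : π w = -1) {W : Submodule K V}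
    (hW : ∀ g, ∀ v ∈ W, ρ g v ∈ W) (g : π.ker) (v : V) (hv : v ∈ hB.perpSubmodule hw W) :
    ρ g v ∈ hB.perpSubmodule hw W := fun u hu => by
  rw [hB.apply_rho_right hw]
  exact hv _ (hW _ u hu)

lemma left_orthogonal_iff (hB : IsHermRep K ι π ρ B) (hw : π w = -1) {W : Submodule K V}
    (hW : ∀ g, ∀ v ∈ W, ρ g v ∈ W) (v : V) :
    (∀ u ∈ W, B w v u = 0) ↔ ∀ u ∈ W, B w u v = 0 := by
  refine ⟨fun h u hu => ?_, fun h u hu => ?_⟩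
  · have := hB.hermitian w hw v u
    rw [h _ (hW _ u hu)] at this
    exact (map_eq_zero ι).1 this.symm
  · have := hB.hermitian w hw v (ρ (sqKer π w)⁻¹ u)
    rwa [rho_rho_inv, h _ (hW _ u hu), map_zero] at this

/-- An invariant subspace is a subrepresentation as soon as one form is nondegenerate on it. -/
lemma isSubrep_of_nondeg (hB : IsHermRep K ι π ρ B) (hw : π w = -1) {S : Submodule K V}
    (hS : ∀ g, ∀ v ∈ S, ρ g v ∈ S) (hn : ∀ v ∈ S, (∀ u ∈ S, B w u v = 0) → v = 0) :
    IsSubrep K π ρ B S := by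
  refine ⟨hS, fun w' hw' => ⟨fun u hu h => ?_, fun v hv h => ?_⟩⟩
  · refine hn u hu ((hB.left_orthogonal_iff hw hS u).1 fun v hv => ?_)
    have := hB.compat w' w hw' hw u (ρ (ratioKer π w w' hw hw')⁻¹ v)
    rwa [rho_rho_inv, h _ (hS _ v hv), eq_comm] at this
  · have h0 := hn _ (hS (ratioKer π w w' hw hw') v hv) fun u hu => by
      rw [← hB.compat w' w hw' hw, h u hu]
    rw [← rho_inv_rho (ρ := ρ) (ratioKer π w w' hw hw') v, h0, map_zero]

/-- Two isotropic simple subspaces that are not orthogonal span a subrepresentation. -/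
lemma isSubrep_sup (hB : IsHermRep K ι π ρ B) (hw : π w = -1) {W U : Submodule K V}
    (hW : IsSimpleGSub K π ρ W) (hU : IsSimpleGSub K π ρ U)
    (hWW : (W : Set V) ⊆ perp B W w) (hUU : (U : Set V) ⊆ perp B U w)
    (hUW : ¬ U ≤ hB.perpSubmodule hw W) : IsSubrep K π ρ B (W ⊔ U) := by
  have hU0 := (hU.inf_eq_bot_or_le (hB.rho_mem_perpSubmodule hw hW.1)).resolve_right hUW
  have hW0 : W ⊓ hB.perpSubmodule hw U = ⊥ :=
    (hW.inf_eq_bot_or_le (hB.rho_mem_perpSubmodule hw hU.1)).resolve_right fun h =>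
      hUW fun x hx => (hB.left_orthogonal_iff hw hW.1 x).1 fun y hy => h hy x hx
  refine hB.isSubrep_of_nondeg hw (fun g v hv => ?_) fun v hv h => ?_
  · obtain ⟨a, ha, b, hb, rfl⟩ := Submodule.mem_sup.1 hv
    rw [map_add]
    exact Submodule.add_mem_sup (hW.1 g a ha) (hU.1 g b hb)
  · obtain ⟨a, ha, b, hb, rfl⟩ := Submodule.mem_sup.1 hv
    have hb0 : b = 0 := (Submodule.eq_bot_iff _).1 hU0 b ⟨hb, fun u hu => by
      have := h u (Submodule.mem_sup_left hu)
      rwa [hB.add_right w hw, hWW ha u hu, zero_add] at this⟩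
    have ha0 : a = 0 := (Submodule.eq_bot_iff _).1 hW0 a ⟨ha, fun u hu => by
      have := h u (Submodule.mem_sup_right hu)
      rwa [hB.add_right w hw, hUU hb u hu, add_zero] at this⟩
    rw [ha0, hb0, add_zero]

/-- An equivariant map that preserves one of the forms preserves all of them. -/
lemma map_eq_of_map_eq (hB : IsHermRep K ι π ρ B) (hw : π w = -1) {f : V → V}
    (hf : ∀ g v, f (ρ g v) = ρ g (f v)) (h : ∀ u v, B w (f u) (f v) = B w u v)
    {w' : Ghat} (hw' : π w' = -1) (u v : V) : B w' (f u) (f v) = B w' u v := by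
  rw [hB.compat w' w hw' hw, hB.compat w' w hw' hw, ← hf, h]

end IsHermRep

end Forms

section Lagrangian

variable {Ghat : Type} [Group Ghat] {π : Ghat →* ℤˣ}
  {V : Type} [AddCommGroup V] [Module ℂ V] {ρ : Representation ℂ π.ker V}
  {B : Ghat → V → V → ℂ} {w : Ghat}

/-- If every simple subspace is isotropic, then isomorphic simple subspaces are orthogonal. -/
lemma IsHermRep.orthogonal_of_iso (hB : IsHRep π ρ B) (hw : π w = -1)
    (hall : ∀ W : Submodule ℂ V, IsSimpleGSub ℂ π ρ W → (W : Set V) ⊆ perp B W w)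
    {W W' : Submodule ℂ V} (hW : IsSimpleGSub ℂ π ρ W) (hW' : IsSimpleGSub ℂ π ρ W')
    {f : V →ₗ[ℂ] V} (hmap : Submodule.map f W = W')
    (hf : ∀ (g : π.ker), ∀ u ∈ W, f (ρ g u) = ρ g (f u)) (hdisj : W ⊓ W' = ⊥) :
    ∀ u ∈ W, ∀ v ∈ W', B w u v = 0 := by
  have hfW : ∀ x ∈ W, f x ∈ W' := fun x hx => hmap ▸ Submodule.mem_map_of_mem hx
  have hgraph : ∀ c : ℂ, IsSimpleGSub ℂ π ρ (W.map (LinearMap.id + c • f)) := by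
    intro c
    have hinj : ∀ x ∈ W, x + c • f x = 0 → x = 0 := fun x hx h0 =>
      (Submodule.eq_bot_iff _).1 hdisj x ⟨hx, by
        rw [eq_neg_of_add_eq_zero_left h0]
        exact W'.neg_mem (W'.smul_mem c (hfW x hx))⟩
    have hequiv : ∀ g, ∀ x ∈ W, (LinearMap.id + c • f : V →ₗ[ℂ] V) (ρ g x) =
        ρ g ((LinearMap.id + c • f : V →ₗ[ℂ] V) x) := fun g x hx => by
      simp [hf g x hx]
    refine ⟨?_, ?_, fun U hU hUinv => ?_⟩
    · rintro g _ ⟨x, hx, rfl⟩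
      exact ⟨ρ g x, hW.1 g x hx, hequiv g x hx⟩
    · intro h0
      obtain ⟨x, hx, hx0⟩ := hW.exists_ne_zero
      exact hx0 (hinj x hx ((Submodule.eq_bot_iff _).1 h0 _ ⟨x, hx, rfl⟩))
    · rcases hW.2.2 (W ⊓ U.comap (LinearMap.id + c • f)) inf_le_left (fun g v hv =>
        ⟨hW.1 g v hv.1, Submodule.mem_comap.2 (hequiv g v hv.1 ▸ hUinv g _ hv.2)⟩) with h | h
      · refine Or.inl ((Submodule.eq_bot_iff _).2 fun y hy => ?_)
        obtain ⟨x, hx, rfl⟩ := hU hy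
        rw [(Submodule.eq_bot_iff _).1 h x ⟨hx, hy⟩, map_zero]
      · refine Or.inr (le_antisymm hU ?_)
        rintro _ ⟨x, hx, rfl⟩
        exact inf_eq_left.1 h hx
  have key : ∀ c : ℂ, ∀ u ∈ W, ∀ v ∈ W, c * B w u (f v) + conj c * B w (f u) v = 0 := by
    intro c u hu v hv
    have h := hall _ (hgraph c) (Submodule.mem_map_of_mem hv) _ (Submodule.mem_map_of_mem hu)
    simp only [LinearMap.add_apply, LinearMap.id_apply, LinearMap.smul_apply, hB.add_left w hw,
      hB.add_right w hw, hB.smul_left w hw, hB.smul_right w hw, hall W hW hv u hu,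
      hall W' hW' (hfW v hv) _ (hfW u hu)] at h
    linear_combination h
  intro u hu v hv
  rw [← hmap] at hv
  obtain ⟨v, hv, rfl⟩ := hv
  have h1 := key 1 u hu v hv
  have hI := key Complex.I u hu v hv
  simp only [map_one, Complex.conj_I] at h1 hI
  linear_combination (1 / 2 : ℂ) * h1 - (Complex.I / 2) * hI +
    ((1 / 2) * B w u (f v) - (1 / 2) * B w (f u) v) * Complex.I_sq

/-- Complementary simple subspaces are not isomorphic if every simple subspace is isotropic. -/
lemma IsHermRep.not_iso_of_isCompl (hB : IsHRep π ρ B) (hw : π w = -1)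
    (hall : ∀ W : Submodule ℂ V, IsSimpleGSub ℂ π ρ W → (W : Set V) ⊆ perp B W w)
    {W W' : Submodule ℂ V} (hW : IsSimpleGSub ℂ π ρ W) (hW' : IsSimpleGSub ℂ π ρ W')
    (hc : IsCompl W W') :
    ¬ ∃ f : V →ₗ[ℂ] V, Set.InjOn f W ∧ Submodule.map f W = W' ∧
      ∀ (g : π.ker), ∀ u ∈ W, f (ρ g u) = ρ g (f u) := by
  rintro ⟨f, -, hmap, hf⟩
  obtain ⟨u, hu, hu0⟩ := hW.exists_ne_zero
  refine hu0 (hB.nondeg_left w hw u fun v => ?_)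
  obtain ⟨a, ha, b, hb, rfl⟩ := Submodule.mem_sup.1 (hc.sup_eq_top ▸ Submodule.mem_top : v ∈ W ⊔ W')
  rw [hB.add_right w hw, hall W hW ha u hu,
    hB.orthogonal_of_iso hw hall hW hW' hmap hf hc.inf_eq_bot u hu b hb, add_zero]

lemma IsHermRep.exists_isCompl_isSimpleGSub [Finite Ghat] [FiniteDimensional ℂ V]
    (hB : IsHRep π ρ B) (hirr : IsIrredRep ℂ π ρ B) (hw : π w = -1)
    (hall : ∀ W : Submodule ℂ V, IsSimpleGSub ℂ π ρ W → (W : Set V) ⊆ perp B W w)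
    {W : Submodule ℂ V} (hW : IsSimpleGSub ℂ π ρ W) :
    ∃ W' : Submodule ℂ V, IsSimpleGSub ℂ π ρ W' ∧ IsCompl W W' ∧ perp B W w = (W : Set V) := by
  have : NeZero (Nat.card π.ker : ℂ) := ⟨Nat.cast_ne_zero.2 Nat.card_pos.ne'⟩
  obtain ⟨C, hC⟩ := exists_isCompl
    (⟨hB.perpSubmodule hw W, fun g v hv => hB.rho_mem_perpSubmodule hw hW.1 g v hv⟩ :
      Subrepresentation ρ)
  have hinf : hB.perpSubmodule hw W ⊓ C.toSubmodule = ⊥ :=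
    congrArg Subrepresentation.toSubmodule hC.inf_eq_bot
  have hsup : hB.perpSubmodule hw W ⊔ C.toSubmodule = ⊤ :=
    congrArg Subrepresentation.toSubmodule hC.sup_eq_top
  have hC0 : C.toSubmodule ≠ ⊥ := fun h0 => by
    rw [h0, sup_bot_eq] at hsup
    obtain ⟨u, hu, hu0⟩ := hW.exists_ne_zero
    exact hu0 (hB.nondeg_left w hw u fun v => (hsup ▸ Submodule.mem_top :
      v ∈ hB.perpSubmodule hw W) u hu)
  obtain ⟨U, hUC, hU⟩ := exists_isSimpleGSub_le (fun g v hv => C.apply_mem_toSubmodule g hv) hC0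
  have hU0 : hB.perpSubmodule hw W ⊓ U = ⊥ := eq_bot_mono (inf_le_inf_left _ hUC) hinf
  have hUW : ¬ U ≤ hB.perpSubmodule hw W := fun h => hU.2.1 (by rwa [inf_eq_right.2 h] at hU0)
  have hWU : W ⊔ U = ⊤ := (hirr.2 _ (hB.isSubrep_sup hw hW hU (hall W hW) (hall U hU)
    hUW)).resolve_left fun h => hW.2.1 (sup_eq_bot_iff.1 h).1
  have hdisj : W ⊓ U = ⊥ :=
    eq_bot_mono (inf_le_inf_right U (hall W hW : W ≤ hB.perpSubmodule hw W)) hU0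
  refine ⟨U, hU, IsCompl.of_eq hdisj hWU, Set.Subset.antisymm (fun v hv => ?_) (hall W hW)⟩
  obtain ⟨a, ha, b, hb, rfl⟩ := Submodule.mem_sup.1 (hWU ▸ Submodule.mem_top : v ∈ W ⊔ U)
  have hb0 : b = 0 := (Submodule.eq_bot_iff _).1 hU0 b ⟨fun u hu => by
    have := hv u hu
    rwa [hB.add_right w hw, hall W hW ha u hu, zero_add] at this, hb⟩
  rwa [hb0, add_zero]

/-- The endomorphism acting by `c` on `W` and by `(conj c)⁻¹` on `W'`. -/
noncomputable def hyperbolicEnd {W W' : Submodule ℂ V} (hc : IsCompl W W') (c : ℂˣ) :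
    V →ₗ[ℂ] V :=
  (c : ℂ) • W.projection W' hc + (conj (c : ℂ))⁻¹ • W'.projection W hc.symm

lemma hyperbolicEnd_add {W W' : Submodule ℂ V} (hc : IsCompl W W') (c : ℂˣ) {a b : V}
    (ha : a ∈ W) (hb : b ∈ W') :
    hyperbolicEnd hc c (a + b) = (c : ℂ) • a + (conj (c : ℂ))⁻¹ • b := by
  have h1 : W.projection W' hc a = a := Submodule.projection_apply_left hc ⟨a, ha⟩
  have h2 : W.projection W' hc b = 0 := (Submodule.projection_apply_eq_zero_iff hc).2 hb
  have h3 : W'.projection W hc.symm a = 0 :=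
    (Submodule.projection_apply_eq_zero_iff hc.symm).2 ha
  have h4 : W'.projection W hc.symm b = b := Submodule.projection_apply_left hc.symm ⟨b, hb⟩
  simp [hyperbolicEnd, h1, h2, h3, h4]

lemma hyperbolicEnd_one {W W' : Submodule ℂ V} (hc : IsCompl W W') (v : V) :
    hyperbolicEnd hc 1 v = v := by
  obtain ⟨a, ha, b, hb, rfl⟩ := Submodule.mem_sup.1 (hc.sup_eq_top ▸ Submodule.mem_top : v ∈ W ⊔ W')
  simp [hyperbolicEnd_add hc 1 ha hb]

lemma hyperbolicEnd_mul {W W' : Submodule ℂ V} (hc : IsCompl W W') (c d : ℂˣ) (v : V) :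
    hyperbolicEnd hc (c * d) v = hyperbolicEnd hc c (hyperbolicEnd hc d v) := by
  obtain ⟨a, ha, b, hb, rfl⟩ := Submodule.mem_sup.1 (hc.sup_eq_top ▸ Submodule.mem_top : v ∈ W ⊔ W')
  rw [hyperbolicEnd_add hc d ha hb, hyperbolicEnd_add hc (c * d) ha hb,
    hyperbolicEnd_add hc c (W.smul_mem _ ha) (W'.smul_mem _ hb)]
  simp [smul_smul, mul_comm]

/-- The automorphism acting by `c` on `W` and by `(conj c)⁻¹` on `W'`. -/
noncomputable def hyperbolicEquiv {W W' : Submodule ℂ V} (hc : IsCompl W W') :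
    ℂˣ →* (V ≃ₗ[ℂ] V) where
  toFun c := LinearEquiv.ofLinearMap (hyperbolicEnd hc c) (hyperbolicEnd hc c⁻¹)
    (by ext v; simp [← hyperbolicEnd_mul, hyperbolicEnd_one])
    (by ext v; simp [← hyperbolicEnd_mul, hyperbolicEnd_one])
  map_one' := LinearEquiv.ext fun v => hyperbolicEnd_one hc v
  map_mul' c d := LinearEquiv.ext fun v => hyperbolicEnd_mul hc c d v

lemma hyperbolicEquiv_add {W W' : Submodule ℂ V} (hc : IsCompl W W') (c : ℂˣ) {a b : V}
    (ha : a ∈ W) (hb : b ∈ W') :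
    hyperbolicEquiv hc c (a + b) = (c : ℂ) • a + (conj (c : ℂ))⁻¹ • b :=
  hyperbolicEnd_add hc c ha hb

lemma IsHermRep.hyperbolicEquiv_mem_autRep (hB : IsHRep π ρ B) (hw : π w = -1)
    {W W' : Submodule ℂ V} (hc : IsCompl W W')
    (hW : ∀ g, ∀ v ∈ W, ρ g v ∈ W) (hW' : ∀ g, ∀ v ∈ W', ρ g v ∈ W')
    (hWW : (W : Set V) ⊆ perp B W w) (hWW' : (W' : Set V) ⊆ perp B W' w) (c : ℂˣ) :
    hyperbolicEquiv hc c ∈ AutRep ℂ π ρ B := by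
  have hdec : ∀ v, ∃ a ∈ W, ∃ b ∈ W', a + b = v := fun v =>
    Submodule.mem_sup.1 (hc.sup_eq_top ▸ Submodule.mem_top)
  have hequiv : ∀ g v, hyperbolicEquiv hc c (ρ g v) = ρ g (hyperbolicEquiv hc c v) := by
    intro g v
    obtain ⟨a, ha, b, hb, rfl⟩ := hdec v
    rw [map_add, hyperbolicEquiv_add hc c (hW g a ha) (hW' g b hb), hyperbolicEquiv_add hc c ha hb,
      map_add, map_smul, map_smul]
  refine ⟨hequiv, fun w' hw' => hB.map_eq_of_map_eq hw hequiv (fun u v => ?_) hw'⟩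
  obtain ⟨a, ha, b, hb, rfl⟩ := hdec u
  obtain ⟨a', ha', b', hb', rfl⟩ := hdec v
  have hcc : conj (c : ℂ) ≠ 0 := (map_ne_zero _).2 c.ne_zero
  simp only [hyperbolicEquiv_add hc c ha hb, hyperbolicEquiv_add hc c ha' hb', hB.add_left w hw,
    hB.add_right w hw, hB.smul_left w hw, hB.smul_right w hw, hWW ha' a ha, hWW' hb' b hb,
    map_inv₀, Complex.conj_conj]
  field_simp [c.ne_zero]
  ring

lemma IsHermRep.exists_hyperbolicEquiv_eq [FiniteDimensional ℂ V] (hB : IsHRep π ρ B)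
    (hw : π w = -1)
    (hall : ∀ W : Submodule ℂ V, IsSimpleGSub ℂ π ρ W → (W : Set V) ⊆ perp B W w)
    {W W' : Submodule ℂ V} (hc : IsCompl W W')
    (hW : IsSimpleGSub ℂ π ρ W) (hW' : IsSimpleGSub ℂ π ρ W')
    {f : V ≃ₗ[ℂ] V} (hf : f ∈ AutRep ℂ π ρ B) : ∃ c : ℂˣ, hyperbolicEquiv hc c = f := by
  obtain ⟨c, hcW⟩ := hW.exists_eq_smul (f := f.toLinearMap) hf.1
    (hW.map_mem_of_not_iso hW' hc (hB.not_iso_of_isCompl hw hall hW hW' hc) hf.1)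
  obtain ⟨d, hdW⟩ := hW'.exists_eq_smul (f := f.toLinearMap) hf.1
    (hW'.map_mem_of_not_iso hW hc.symm (hB.not_iso_of_isCompl hw hall hW' hW hc.symm) hf.1)
  simp only [LinearEquiv.coe_coe] at hcW hdW
  have hdec : ∀ v, ∃ a ∈ W, ∃ b ∈ W', a + b = v := fun v =>
    Submodule.mem_sup.1 (hc.sup_eq_top ▸ Submodule.mem_top)
  have hcd : conj c * d = 1 := by
    by_contra hne
    obtain ⟨u, hu, hu0⟩ := hW.exists_ne_zero
    refine hu0 (hB.nondeg_left w hw u fun v => ?_)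
    obtain ⟨a, ha, b, hb, rfl⟩ := hdec v
    have h := hf.2 w hw u b
    rw [hcW u hu, hdW b hb, hB.smul_left w hw, hB.smul_right w hw] at h
    rw [hB.add_right w hw, hall W hW ha u hu, zero_add]
    have h' : (conj c * d - 1) * B w u b = 0 := by linear_combination h
    exact (mul_eq_zero.1 h').resolve_left (sub_ne_zero.2 hne)
  have hc0 : c ≠ 0 := fun h => by simp [h] at hcd
  refine ⟨Units.mk0 c hc0, LinearEquiv.ext fun v => ?_⟩
  obtain ⟨a, ha, b, hb, rfl⟩ := hdec v
  rw [hyperbolicEquiv_add hc _ ha hb, map_add, hcW a ha, hdW b hb, Units.val_mk0,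
    eq_inv_of_mul_eq_one_right hcd]

end Lagrangian

/-- Case (2) of the structure theorem for irreducible `H`-representations: if every simple
`ℂG`-submodule is contained in its own orthogonal complement, then every simple `ℂG`-submodule
`W` has a simple complement `W'` with `V = W ⊕ W'`, `W^⊥ = W`, `W ≇ W'` as `ℂG`-modules, and
`Aut_H(V) ≅ ℂˣ` as groups. -/
theorem irred_H_rep_case2
    {Ghat : Type} [Group Ghat] [Finite Ghat] (π : Ghat →* ℤˣ)
    (hπ : Function.Surjective π)
    {V : Type} [AddCommGroup V] [Module ℂ V] [FiniteDimensional ℂ V]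
    (ρ : Representation ℂ π.ker V) (B : Ghat → V → V → ℂ)
    (hB : IsHRep π ρ B) (hirr : IsIrredRep ℂ π ρ B)
    (w₀ : Ghat) (hw₀ : π w₀ = -1)
    (hall : ∀ W : Submodule ℂ V, IsSimpleGSub ℂ π ρ W → (W : Set V) ⊆ perp B W w₀) :
    (∀ W : Submodule ℂ V, IsSimpleGSub ℂ π ρ W →
      ∃ W' : Submodule ℂ V, IsSimpleGSub ℂ π ρ W' ∧ W ⊓ W' = ⊥ ∧ W ⊔ W' = ⊤ ∧
        perp B W w₀ = (W : Set V) ∧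
        ¬ ∃ f : V →ₗ[ℂ] V, Set.InjOn f W ∧ Submodule.map f W = W' ∧
          ∀ (g : π.ker), ∀ u ∈ W, f (ρ g u) = ρ g (f u)) ∧
    Nonempty (AutRep ℂ π ρ B ≃* ℂˣ) := by
  refine ⟨fun W hW => ?_, ?_⟩
  · obtain ⟨W', hW', hc, hperp⟩ := hB.exists_isCompl_isSimpleGSub hirr hw₀ hall hW
    exact ⟨W', hW', hc.inf_eq_bot, hc.sup_eq_top, hperp,
      hB.not_iso_of_isCompl hw₀ hall hW hW' hc⟩
  · obtain ⟨v, hv⟩ := hirr.1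
    obtain ⟨W, -, hW⟩ := exists_isSimpleGSub_le (ρ := ρ) (C := ⊤) (fun _ _ _ => Submodule.mem_top)
      ((Submodule.ne_bot_iff _).2 ⟨v, Submodule.mem_top, hv⟩)
    obtain ⟨W', hW', hc, -⟩ := hB.exists_isCompl_isSimpleGSub hirr hw₀ hall hW
    refine ⟨(MulEquiv.ofBijective ((hyperbolicEquiv hc).codRestrict (AutRep ℂ π ρ B)
      (hB.hyperbolicEquiv_mem_autRep hw₀ hc hW.1 hW'.1 (hall W hW) (hall W' hW')))
      ⟨fun c d hcd => ?_, fun f => ?_⟩).symm⟩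
    · obtain ⟨x, hx, hx0⟩ := hW.exists_ne_zero
      have h := DFunLike.congr_fun (congrArg Subtype.val hcd) (x + 0)
      simp only [MonoidHom.codRestrict_apply] at h
      rw [hyperbolicEquiv_add hc _ hx W'.zero_mem, hyperbolicEquiv_add hc _ hx W'.zero_mem,
        smul_zero, smul_zero, add_zero, add_zero] at h
      exact Units.ext (smul_left_injective ℂ hx0 h)
    · obtain ⟨c, hcf⟩ := hB.exists_hyperbolicEquiv_eq hw₀ hall hc hW hW' f.2
      exact ⟨c, Subtype.ext hcf⟩
end

section
/- Let (Ĝ, π) be a C₂-graded finite group and let (V, ρ) be a finite-dimensional complex representation of G = ker π that is NOT simple as a ℂG-module. If (B_w) and (B̃_w) are two families of forms each making (V, ρ) an irreducible H-representation of (Ĝ, π), then (V, ρ, (B_w)) and (V, ρ, (B̃_w)) are isomorphic as H-representations. -/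
open scoped ComplexConjugate

namespace HRep

open Module

variable {Ghat : Type} [Group Ghat] {π : Ghat →* ℤˣ} {V : Type} [AddCommGroup V] [Module ℂ V]
  {ρ : Representation ℂ π.ker V} {B Bt : Ghat → V → V → ℂ} {w : Ghat}

theorem zero_left (hB : IsHRep π ρ B) (hw : π w = -1) (v : V) : B w 0 v = 0 := by
  simpa using hB.smul_left w hw 0 0 v

theorem zero_right (hB : IsHRep π ρ B) (hw : π w = -1) (u : V) : B w u 0 = 0 := by
  simpa using hB.smul_right w hw 0 u 0

theorem rho_inv_apply (ρ : Representation ℂ π.ker V) (g : π.ker) (v : V) :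
    ρ g⁻¹ (ρ g v) = v := by
  rw [← Module.End.mul_apply, ← map_mul, inv_mul_cancel, map_one, Module.End.one_apply]

theorem rho_apply_inv (ρ : Representation ℂ π.ker V) (g : π.ker) (v : V) :
    ρ g (ρ g⁻¹ v) = v := by
  rw [← Module.End.mul_apply, ← map_mul, mul_inv_cancel, map_one, Module.End.one_apply]

/-- The right orthogonal complement of a submodule, as a submodule. -/
def rightPerp (hB : IsHRep π ρ B) (hw : π w = -1) (S : Submodule ℂ V) : Submodule ℂ V where
  carrier := perp B S w
  add_mem' {a b} ha hb u hu := by rw [hB.add_right w hw, ha u hu, hb u hu, add_zero]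
  zero_mem' u _ := zero_right hB hw u
  smul_mem' c x hx u hu := by rw [hB.smul_right w hw, hx u hu, mul_zero]

theorem rightPerp_invariant (hB : IsHRep π ρ B) (hw : π w = -1) {S : Submodule ℂ V}
    (hS : ∀ g : π.ker, ∀ v ∈ S, ρ g v ∈ S) (g : π.ker) (v : V) (hv : v ∈ rightPerp hB hw S) :
    ρ g v ∈ rightPerp hB hw S := by
  intro u hu
  have hg : conjKer π w (conjKer π w⁻¹ g) = g := by
    ext; simp [conjKer, mul_assoc]
  have key := hB.invariant w hw (conjKer π w⁻¹ g) (ρ (conjKer π w⁻¹ g)⁻¹ u) v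
  rw [hg, rho_apply_inv] at key
  rw [key]
  exact hv _ (hS _ _ hu)

/-- Vanishing of one form is symmetric up to the action of `w²`. -/
theorem eq_zero_iff_swap (hB : IsHRep π ρ B) (hw : π w = -1) (u v : V) :
    B w u (ρ (sqKer π w) v) = 0 ↔ B w v u = 0 := by
  rw [hB.hermitian w hw, map_eq_zero]

/-- Nondegeneracy on an invariant subspace only has to be tested on the right and
for a single odd element. -/
theorem isSubrep_of_nondeg (hB : IsHRep π ρ B) (hw : π w = -1) {W : Submodule ℂ V}
    (hW : ∀ g : π.ker, ∀ v ∈ W, ρ g v ∈ W)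
    (hn : ∀ v ∈ W, (∀ u ∈ W, B w u v = 0) → v = 0) : IsSubrep ℂ π ρ B W := by
  have key : ∀ z, π z = -1 → ∀ v ∈ W, (∀ u ∈ W, B z u v = 0) → v = 0 := by
    intro z hz v hv h
    have h0 : ρ (ratioKer π w z hw hz) v = 0 := by
      refine hn _ (hW _ _ hv) fun u hu => ?_
      rw [← hB.compat z w hz hw]
      exact h u hu
    rw [← rho_inv_apply ρ (ratioKer π w z hw hz) v, h0, map_zero]
  refine ⟨hW, fun z hz => ⟨fun u hu h => ?_, key z hz⟩⟩
  have h0 : ρ (sqKer π z) u = 0 :=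
    key z hz _ (hW _ _ hu) fun v hv => (eq_zero_iff_swap hB hz v u).2 (h v hv)
  rw [← rho_inv_apply ρ (sqKer π z) u, h0, map_zero]

theorem le_or_disjoint {S K : Submodule ℂ V} (hS : IsSimpleGSub ℂ π ρ S)
    (hK : ∀ g : π.ker, ∀ v ∈ K, ρ g v ∈ K) : S ≤ K ∨ Disjoint S K := by
  rcases hS.2.2 (S ⊓ K) inf_le_left fun g v hv => ⟨hS.1 g v hv.1, hK g v hv.2⟩ with h | h
  · exact .inr (disjoint_iff.2 h)
  · exact .inl (inf_eq_left.1 h)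

/-- In an irreducible `H`-representation whose underlying module is not simple, every simple
submodule is totally isotropic. -/
theorem isotropic_of_simple (hB : IsHRep π ρ B) (hirr : IsIrredRep ℂ π ρ B)
    (hns : ¬ IsSimpleGSub ℂ π ρ (⊤ : Submodule ℂ V)) (hw : π w = -1)
    {S : Submodule ℂ V} (hS : IsSimpleGSub ℂ π ρ S) : S ≤ rightPerp hB hw S := by
  refine (le_or_disjoint hS (rightPerp_invariant hB hw hS.1)).resolve_right fun hd => ?_
  rcases hirr.2 S (isSubrep_of_nondeg hB hw hS.1
    fun v hv h => Submodule.disjoint_def.1 hd v hv h) with h | h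
  · exact hS.2.1 h
  · exact hns (h ▸ hS)

/-- In an irreducible `H`-representation whose underlying module is not simple, two simple
submodules that are not orthogonal to each other span the whole space. -/
theorem sup_eq_top (hB : IsHRep π ρ B) (hirr : IsIrredRep ℂ π ρ B)
    (hns : ¬ IsSimpleGSub ℂ π ρ (⊤ : Submodule ℂ V)) (hw : π w = -1)
    {S S' : Submodule ℂ V} (hS : IsSimpleGSub ℂ π ρ S) (hS' : IsSimpleGSub ℂ π ρ S')
    (hnot : ¬ S' ≤ rightPerp hB hw S) : S ⊔ S' = ⊤ := by
  have hd := (le_or_disjoint hS' (rightPerp_invariant hB hw hS.1)).resolve_left hnot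
  have hnot' : ¬ S ≤ rightPerp hB hw S' := fun hle => hnot fun v hv u hu => by
    rw [← rho_apply_inv ρ (sqKer π w) v, eq_zero_iff_swap hB hw]
    exact hle hu _ (hS'.1 _ _ hv)
  have hd' := (le_or_disjoint hS (rightPerp_invariant hB hw hS'.1)).resolve_left hnot'
  have hiso := isotropic_of_simple hB hirr hns hw hS
  have hiso' := isotropic_of_simple hB hirr hns hw hS'
  have hinv : ∀ g : π.ker, ∀ v ∈ S ⊔ S', ρ g v ∈ S ⊔ S' := by
    intro g v hv
    obtain ⟨s, hs, s', hs', rfl⟩ := Submodule.mem_sup.1 hv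
    rw [map_add]
    exact Submodule.add_mem_sup (hS.1 g s hs) (hS'.1 g s' hs')
  have hsub : IsSubrep ℂ π ρ B (S ⊔ S') := by
    refine isSubrep_of_nondeg hB hw hinv fun v hv h => ?_
    obtain ⟨s, hs, s', hs', rfl⟩ := Submodule.mem_sup.1 hv
    have h1 : s' = 0 := Submodule.disjoint_def.1 hd s' hs' fun u hu => by
      have := h u (Submodule.mem_sup_left hu)
      rwa [hB.add_right w hw, hiso hs u hu, zero_add] at this
    have h2 : s = 0 := Submodule.disjoint_def.1 hd' s hs fun u hu => by
      have := h u (Submodule.mem_sup_right hu)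
      rwa [hB.add_right w hw, hiso' hs' u hu, add_zero] at this
    rw [h1, h2, add_zero]
  refine (hirr.2 _ hsub).resolve_left fun h => hS.2.1 ?_
  exact eq_bot_iff.2 (h ▸ le_sup_left)

/-- By Maschke's theorem, the simple submodules are not all contained in a proper one. -/
theorem exists_simple_not_le [Finite Ghat] [FiniteDimensional ℂ V]
    (ρ : Representation ℂ π.ker V) {N : Submodule ℂ V}
    (hN : ∀ g : π.ker, ∀ v ∈ N, ρ g v ∈ N) (hne : N ≠ ⊤) :
    ∃ S : Submodule ℂ V, IsSimpleGSub ℂ π ρ S ∧ ¬ S ≤ N := by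
  have hss : Representation.IsSemisimpleRepresentation ρ := by
    have : NeZero (Nat.card π.ker : ℂ) := ⟨Nat.cast_ne_zero.2 Nat.card_pos.ne'⟩
    infer_instance
  obtain ⟨M, hM⟩ := hss.exists_isCompl (⟨N, fun g v hv => hN g v hv⟩ : Subrepresentation ρ)
  have hinf : N ⊓ M.toSubmodule = ⊥ :=
    congrArg Subrepresentation.toSubmodule hM.inf_eq_bot
  have hsup : N ⊔ M.toSubmodule = ⊤ :=
    congrArg Subrepresentation.toSubmodule hM.sup_eq_top
  have hM0 : M.toSubmodule ≠ ⊥ := fun h => hne (by rw [← hsup, h, sup_bot_eq])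
  obtain ⟨S, ⟨hSM, hS0, hSinv⟩, hmin⟩ := (wellFounded_lt (α := Submodule ℂ V)).has_min
    {U | U ≤ M.toSubmodule ∧ U ≠ ⊥ ∧ ∀ g : π.ker, ∀ v ∈ U, ρ g v ∈ U}
    ⟨_, le_rfl, hM0, fun g v hv => M.apply_mem_toSubmodule g hv⟩
  refine ⟨S, ⟨hSinv, hS0, fun U hU hUinv => ?_⟩, fun hle => hS0 ?_⟩
  · by_cases h : U = ⊥
    · exact .inl h
    · exact .inr (hU.eq_of_not_lt (hmin U ⟨hU.trans hSM, h, hUinv⟩))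
  · exact eq_bot_iff.2 (hinf ▸ le_inf hle hSM)

/-- Schur's lemma for a simple submodule preserved by an equivariant operator. -/
theorem exists_scalar_of_simple [FiniteDimensional ℂ V] {S : Submodule ℂ V}
    (hS : IsSimpleGSub ℂ π ρ S) (T : V →ₗ[ℂ] V) (hT : ∀ (g : π.ker) (v : V), T (ρ g v) = ρ g (T v))
    (hTS : ∀ v ∈ S, T v ∈ S) : ∃ a : ℂ, ∀ v ∈ S, T v = a • v := by
  have : Nontrivial S := Submodule.nontrivial_iff_ne_bot.2 hS.2.1
  obtain ⟨a, ha⟩ := Module.End.exists_eigenvalue (T.restrict hTS)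
  obtain ⟨x, hx⟩ := ha.exists_hasEigenvector
  have hxa : T x = a • (x : V) := congrArg Subtype.val hx.apply_eq_smul
  refine ⟨a, fun v hv => Module.End.mem_eigenspace_iff.1 ?_⟩
  refine (le_or_disjoint hS (K := Module.End.eigenspace T a) fun g u hu => ?_).resolve_right
    (fun hd => hx.2 ?_) hv
  · rw [Module.End.mem_eigenspace_iff] at hu ⊢
    rw [hT, hu, map_smul]
  · exact Subtype.ext
      (Submodule.disjoint_def.1 hd x x.2 (Module.End.mem_eigenspace_iff.2 hxa))

/-- Every linear functional is represented on the left by a nondegenerate sesquilinear form. -/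
theorem exists_left_representative [FiniteDimensional ℂ V] (hB : IsHRep π ρ B) (hw : π w = -1)
    (φ : Dual ℂ V) : ∃ t : V, ∀ v, B w t v = φ v := by
  let Φ : V →ₗ[ℝ] Dual ℂ V :=
    { toFun := fun u =>
        { toFun := B w u
          map_add' := hB.add_right w hw u
          map_smul' := fun a v => hB.smul_right w hw a u v }
      map_add' := fun u u' => LinearMap.ext fun v => hB.add_left w hw u u' v
      map_smul' := fun a u => LinearMap.ext fun v => by
        have := hB.smul_left w hw (a : ℂ) u v
        rw [Complex.conj_ofReal] at this
        simpa using this }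
  have : FiniteDimensional ℝ V := FiniteDimensional.complexToReal V
  have : FiniteDimensional ℝ (Dual ℂ V) := FiniteDimensional.complexToReal _
  have hinj : Function.Injective Φ := (injective_iff_map_eq_zero Φ).2 fun u hu =>
    hB.nondeg_left w hw u fun v => LinearMap.congr_fun hu v
  have hdim : finrank ℝ V = finrank ℝ (Dual ℂ V) := by
    rw [finrank_real_of_complex, finrank_real_of_complex, Subspace.dual_finrank_eq]
  obtain ⟨t, ht⟩ := (LinearMap.injective_iff_surjective_of_finrank_eq_finrank hdim).1 hinj φ
  exact ⟨t, fun v => LinearMap.congr_fun ht v⟩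

theorem eq_of_forall_left (hB : IsHRep π ρ B) (hw : π w = -1) {x y : V}
    (h : ∀ v, B w x v = B w y v) : x = y := by
  rw [← sub_eq_zero]
  refine hB.nondeg_left w hw _ fun v => ?_
  have := hB.smul_left w hw (-1) y v
  rw [sub_eq_add_neg, hB.add_left w hw, h v, ← neg_one_smul ℂ y, this]
  simp

/-- Two `H`-structures on the same representation differ by an equivariant operator. -/
theorem exists_comparison [FiniteDimensional ℂ V] (hB : IsHRep π ρ B) (hBt : IsHRep π ρ Bt)
    (hw : π w = -1) : ∃ T : V →ₗ[ℂ] V, (∀ u v, Bt w u v = B w (T u) v) ∧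
      ∀ (g : π.ker) (v : V), T (ρ g v) = ρ g (T v) := by
  have hex : ∀ u, ∃ t, ∀ v, B w t v = Bt w u v := fun u =>
    exists_left_representative hB hw
      { toFun := Bt w u
        map_add' := hBt.add_right w hw u
        map_smul' := fun a v => hBt.smul_right w hw a u v }
  choose T hT using hex
  refine ⟨{ toFun := T, map_add' := fun u u' => ?_, map_smul' := fun a u => ?_ },
    fun u v => (hT u v).symm, fun g u => ?_⟩
  · refine eq_of_forall_left hB hw fun v => ?_
    rw [hT, hB.add_left w hw, hT, hT, hBt.add_left w hw]
  · refine eq_of_forall_left hB hw fun v => ?_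
    rw [hT, RingHom.id_apply, hB.smul_left w hw, hT, hBt.smul_left w hw]
  · refine eq_of_forall_left hB hw fun v => ?_
    change B w (T (ρ g u)) v = B w (ρ g (T u)) v
    rw [hT, ← rho_apply_inv ρ (conjKer π w g) v, hB.invariant w hw, hBt.invariant w hw, hT]

/-- An isotropic subspace with an isotropic supplement is its own left orthogonal complement. -/
theorem mem_of_left_orthogonal (hB : IsHRep π ρ B) (hw : π w = -1) {S S' : Submodule ℂ V}
    (hsup : S ⊔ S' = ⊤) (hS : S ≤ rightPerp hB hw S) (hS' : S' ≤ rightPerp hB hw S')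
    {x : V} (hx : ∀ v ∈ S, B w x v = 0) : x ∈ S := by
  obtain ⟨s, hs, s', hs', rfl⟩ := Submodule.mem_sup.1 (hsup ▸ Submodule.mem_top : x ∈ S ⊔ S')
  have h0 : s' = 0 := hB.nondeg_left w hw s' fun v => by
    obtain ⟨t, ht, t', ht', rfl⟩ := Submodule.mem_sup.1 (hsup ▸ Submodule.mem_top : v ∈ S ⊔ S')
    have := hx t ht
    rw [hB.add_left w hw, hS ht s hs, zero_add] at this
    rw [hB.add_right w hw, this, hS' ht' s' hs', add_zero]
  rwa [h0, add_zero]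

theorem disjoint_of_isotropic (hB : IsHRep π ρ B) (hw : π w = -1) {S S' : Submodule ℂ V}
    (hsup : S ⊔ S' = ⊤) (hS : S ≤ rightPerp hB hw S) (hS' : S' ≤ rightPerp hB hw S') :
    Disjoint S S' := by
  refine Submodule.disjoint_def.2 fun x hx hx' => hB.nondeg_left w hw x fun v => ?_
  obtain ⟨t, ht, t', ht', rfl⟩ := Submodule.mem_sup.1 (hsup ▸ Submodule.mem_top : v ∈ S ⊔ S')
  rw [hB.add_right w hw, hS ht x hx, hS' ht' x hx', add_zero]

/-- A linear map intertwining the forms of one odd element intertwines those of all of them. -/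
theorem preserves_of_preserves_one (hB : IsHRep π ρ B) (hBt : IsHRep π ρ Bt) (hw : π w = -1)
    {f : V →ₗ[ℂ] V} (hf : ∀ (g : π.ker) (v : V), f (ρ g v) = ρ g (f v))
    (h : ∀ u v, Bt w (f u) (f v) = B w u v) (z : Ghat) (hz : π z = -1) (u v : V) :
    Bt z (f u) (f v) = B z u v := by
  rw [hBt.compat z w hz hw, hB.compat z w hz hw, ← hf, h]

end HRep

/-- If the underlying `ℂG`-module is not simple, then any two irreducible `H`-structures on it
are isomorphic. -/
theorem H_rep_nonsimple_determined
    {Ghat : Type} [Group Ghat] [Finite Ghat] (π : Ghat →* ℤˣ)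
    (hπ : Function.Surjective π)
    {V : Type} [AddCommGroup V] [Module ℂ V] [FiniteDimensional ℂ V]
    (ρ : Representation ℂ π.ker V)
    (hnsimple : ¬ IsSimpleGSub ℂ π ρ (⊤ : Submodule ℂ V))
    (B Bt : Ghat → V → V → ℂ)
    (hB : IsHRep π ρ B) (hirrB : IsIrredRep ℂ π ρ B)
    (hBt : IsHRep π ρ Bt) (hirrBt : IsIrredRep ℂ π ρ Bt) :
    ∃ f : V →ₗ[ℂ] V, Function.Bijective f ∧
      (∀ (g : π.ker) (v : V), f (ρ g v) = ρ g (f v)) ∧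
      (∀ w, π w = -1 → ∀ u v : V, Bt w (f u) (f v) = B w u v) := by
  obtain ⟨w, hw⟩ := hπ (-1)
  have hV : Nontrivial V := let ⟨v, hv⟩ := hirrB.1; ⟨v, 0, hv⟩
  obtain ⟨S, hS, -⟩ := HRep.exists_simple_not_le ρ (N := ⊥)
    (fun g v hv => by rw [(Submodule.mem_bot ℂ).1 hv, map_zero]; exact zero_mem _) bot_ne_top
  obtain ⟨S', hS', hnot⟩ := HRep.exists_simple_not_le ρ
    (HRep.rightPerp_invariant hB hw hS.1) fun htop => hS.2.1 <| eq_bot_iff.2 fun s hs =>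
      hB.nondeg_left w hw s fun v =>
        (htop ▸ Submodule.mem_top : v ∈ HRep.rightPerp hB hw S) s hs
  have hsup := HRep.sup_eq_top hB hirrB hnsimple hw hS hS' hnot
  have hI := HRep.isotropic_of_simple hB hirrB hnsimple hw hS
  have hI' := HRep.isotropic_of_simple hB hirrB hnsimple hw hS'
  have hJ := HRep.isotropic_of_simple hBt hirrBt hnsimple hw hS
  have hJ' := HRep.isotropic_of_simple hBt hirrBt hnsimple hw hS'
  have hcompl : IsCompl S S' :=
    ⟨HRep.disjoint_of_isotropic hB hw hsup hI hI', codisjoint_iff.2 hsup⟩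
  obtain ⟨T, hT, hTρ⟩ := HRep.exists_comparison hB hBt hw
  obtain ⟨a, ha⟩ := HRep.exists_scalar_of_simple hS T hTρ fun u hu =>
    HRep.mem_of_left_orthogonal hB hw hsup hI hI' fun v hv => by rw [← hT]; exact hJ hv u hu
  obtain ⟨b, hb⟩ := HRep.exists_scalar_of_simple hS' T hTρ fun u hu =>
    HRep.mem_of_left_orthogonal hB hw (sup_comm S S' ▸ hsup) hI' hI fun v hv => by
      rw [← hT]; exact hJ' hv u hu
  have hBa : ∀ u ∈ S, ∀ v, Bt w u v = conj a * B w u v := fun u hu v => by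
    rw [hT, ha u hu, hB.smul_left w hw]
  have hBb : ∀ u ∈ S', ∀ v, Bt w u v = conj b * B w u v := fun u hu v => by
    rw [hT, hb u hu, hB.smul_left w hw]
  have hab : conj b = a := by
    have hex : ∃ v ∈ S', ∃ u ∈ S, B w u v ≠ 0 := by
      by_contra! h
      exact hnot h
    obtain ⟨v, hv, u, hu, hne⟩ := hex
    have h1 := hBt.hermitian w hw v u
    rw [hBb v hv, hBa u hu, hB.hermitian w hw, map_mul, Complex.conj_conj] at h1
    exact mul_right_cancel₀ ((map_ne_zero _).2 hne) h1
  have ha0 : a ≠ 0 := by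
    rintro rfl
    obtain ⟨s, hs, hs0⟩ := Submodule.exists_mem_ne_zero_of_ne_bot hS.2.1
    exact hs0 (hBt.nondeg_left w hw s fun v => by rw [hBa s hs, map_zero, zero_mul])
  have hdecomp : ∀ v, ∃ s ∈ S, ∃ s' ∈ S', s + s' = v := fun v =>
    Submodule.mem_sup.1 (hsup ▸ Submodule.mem_top)
  let P := S.projection S' hcompl
  have hPS : ∀ s ∈ S, P s = s := fun s hs => Submodule.projection_apply_of_mem_left hcompl hs
  have hPS' : ∀ s ∈ S', P s = 0 := fun s hs =>
    (Submodule.projection_apply_eq_zero_iff hcompl).2 hs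
  let f : V →ₗ[ℂ] V := a⁻¹ • P + (LinearMap.id - P)
  have hfS : ∀ s ∈ S, f s = a⁻¹ • s := fun s hs => by simp [f, hPS s hs]
  have hfS' : ∀ s ∈ S', f s = s := fun s hs => by simp [f, hPS' s hs]
  have hfρ : ∀ (g : π.ker) (v : V), f (ρ g v) = ρ g (f v) := by
    intro g v
    obtain ⟨s, hs, s', hs', rfl⟩ := hdecomp v
    simp only [map_add, hfS s hs, hfS' s' hs', hfS _ (hS.1 g s hs), hfS' _ (hS'.1 g s' hs'),
      map_smul]
  have hfB : ∀ u v, Bt w (f u) (f v) = B w u v := by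
    intro u v
    obtain ⟨s, hs, s', hs', rfl⟩ := hdecomp u
    obtain ⟨t, ht, t', ht', rfl⟩ := hdecomp v
    simp only [map_add, hfS s hs, hfS' s' hs', hfS t ht, hfS' t' ht', hB.add_left w hw,
      hB.add_right w hw, hBt.add_left w hw, hBt.add_right w hw, hBt.smul_left w hw,
      hBt.smul_right w hw, hBa s hs, hBb s' hs', hI ht s hs, hI' ht' s' hs', hab, map_inv₀]
    have hca : conj a ≠ 0 := (map_ne_zero _).2 ha0
    field_simp
    ring
  have hinj : Function.Injective f := (injective_iff_map_eq_zero f).2 fun u hu =>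
    hB.nondeg_left w hw u fun v => by rw [← hfB, hu, HRep.zero_left hBt hw]
  exact ⟨f, ⟨hinj, LinearMap.injective_iff_surjective.1 hinj⟩, hfρ,
    HRep.preserves_of_preserves_one hB hBt hw hfρ hfB⟩
end

section
/- Let (Ĝ, π) be a C₂-graded finite group and let (V, ρ) be a finite-dimensional complex representation of G = ker π. Then ρ extends to a ℂ-linear representation of the whole group Ĝ on V if and only if there exists a family of nondegenerate sesquilinear forms (B_w), one for each odd w ∈ Ĝ \ G, making (V, ρ) an H-representation of (Ĝ, π). -/
open scoped ComplexConjugate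

/-- Weyl's unitary trick: a finite-dimensional complex representation of a finite group carries
an invariant inner product. -/
theorem Representation.exists_invariant_innerProductSpaceCore
    {H : Type*} [Group H] [Finite H] {V : Type*} [AddCommGroup V] [Module ℂ V]
    [FiniteDimensional ℂ V] (σ : Representation ℂ H V) :
    ∃ c : InnerProductSpace.Core ℂ V, ∀ (g : H) (u v : V),
      c.inner (σ g u) (σ g v) = c.inner u v := by
  classical
  have := Fintype.ofFinite H
  let b := Module.finBasis ℂ V
  have hself (x : V) : ∑ g, ∑ i, conj (b.repr (σ g x) i) * b.repr (σ g x) i =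
      ((∑ g, ∑ i, Complex.normSq (b.repr (σ g x) i) : ℝ) : ℂ) := by
    simp [Complex.normSq_eq_conj_mul_self]
  refine ⟨{ inner := fun u v => ∑ g, ∑ i, conj (b.repr (σ g u) i) * b.repr (σ g v) i
            conj_inner_symm := fun x y => by simp [mul_comm]
            re_inner_nonneg := fun x => ?_
            add_left := fun x y z => by simp [add_mul, Finset.sum_add_distrib]
            smul_left := fun x y r => by simp [Finset.mul_sum, mul_assoc]
            definite := fun x hx => ?_ }, fun h u v => ?_⟩
  · rw [hself]
    exact Finset.sum_nonneg fun g _ => Finset.sum_nonneg fun i _ => Complex.normSq_nonneg _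
  · rw [hself, Complex.ofReal_eq_zero, Finset.sum_eq_zero_iff_of_nonneg
      fun g _ => Finset.sum_nonneg fun i _ => Complex.normSq_nonneg _] at hx
    have h1 := hx 1 (Finset.mem_univ _)
    rw [Finset.sum_eq_zero_iff_of_nonneg fun i _ => Complex.normSq_nonneg _] at h1
    apply b.repr.injective
    ext i
    simpa using h1 i (Finset.mem_univ i)
  · exact Fintype.sum_equiv (Equiv.mulRight h) _ _ fun g => by simp [map_mul]

/-- An injective symmetric endomorphism has an inverse square root, which can be chosen to commute
with everything that commutes with the endomorphism. -/
theorem LinearMap.IsSymmetric.exists_inverse_sqrt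
    {V : Type*} [NormedAddCommGroup V] [InnerProductSpace ℂ V] [FiniteDimensional ℂ V]
    {P : Module.End ℂ V} (hP : P.IsSymmetric) (hinj : Function.Injective P) :
    ∃ Q : Module.End ℂ V, Q * Q * P = 1 ∧ ∀ X, Commute X P → Commute X Q := by
  classical
  let s := P.finite_hasEigenvalue.toFinset
  choose r hr using fun z : ℂ => IsAlgClosed.exists_eq_mul_self z⁻¹
  let p := Lagrange.interpolate s _root_.id r
  refine ⟨Polynomial.aeval P p, ?_, fun X hX => ?_⟩
  · have htop : (⨆ μ, Module.End.eigenspace P μ) = ⊤ :=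
      (Submodule.orthogonal_eq_bot_iff).1 hP.orthogonalComplement_iSup_eigenspaces_eq_bot
    rw [← sub_eq_zero, ← LinearMap.ker_eq_top, eq_top_iff, ← htop]
    refine iSup_le fun μ x hx => ?_
    by_cases hx0 : x = 0
    · simp [hx0]
    have hv : P.HasEigenvector μ x := ⟨hx, hx0⟩
    have hμ : μ ∈ s := by simpa [s] using Module.End.hasEigenvalue_of_hasEigenvector hv
    have hμ0 : μ ≠ 0 := by
      rintro rfl
      exact hx0 (hinj (by simpa using Module.End.mem_eigenspace_iff.1 hx))
    have hp : p.eval μ = r μ := Lagrange.eval_interpolate_at_node (v := _root_.id) r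
      (Set.injOn_id _) hμ
    have hQ : Polynomial.aeval P p x = r μ • x := by
      rw [Module.End.aeval_apply_of_hasEigenvector hv, hp]
    have hPx : P x = μ • x := Module.End.mem_eigenspace_iff.1 hx
    simp only [LinearMap.mem_ker, LinearMap.sub_apply, Module.End.mul_apply, hPx, map_smul, hQ,
      Module.End.one_apply, smul_smul]
    rw [← hr, mul_inv_cancel₀ hμ0, one_smul, sub_self]
  · induction p using Polynomial.induction_on' with
    | add p q hp hq => simpa using hp.add_right hq
    | monomial n a =>
      rw [Polynomial.aeval_monomial]
      exact (Algebra.commute_algebraMap_right a X).mul_right (hX.pow_right n)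

/-- A homomorphism on the even part of a graded group extends to the whole group once an odd
element `w` is given an image compatible with conjugation by `w` and with `w²`. -/
theorem exists_monoidHom_extending_ker {Γ M : Type*} [Group Γ] [Monoid M] (π : Γ →* ℤˣ)
    (f : π.ker →* M) (w : Γ) (hw : π w = -1) (S : M)
    (hconj : ∀ g g' : π.ker, (g' : Γ) = w * g * w⁻¹ → S * f g = f g' * S)
    (hsq : ∀ g : π.ker, (g : Γ) = w * w → S * S = f g) :
    ∃ F : Γ →* M, ∀ g : π.ker, F g = f g := by
  classical
  let f' : Γ → M := fun x => if h : π x = 1 then f ⟨x, h⟩ else 1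
  have hf' {x : Γ} (h : π x = 1) : f' x = f ⟨x, h⟩ := dif_pos h
  have hmul {x y : Γ} (hx : π x = 1) (hy : π y = 1) : f' (x * y) = f' x * f' y := by
    rw [hf' hx, hf' hy, hf' (show π (x * y) = 1 by simp [hx, hy])]
    exact map_mul f ⟨x, hx⟩ ⟨y, hy⟩
  have hc {x : Γ} (hx : π x = 1) : S * f' x = f' (w * x * w⁻¹) * S := by
    rw [hf' hx, hf' (by simp [hx])]
    exact hconj _ _ rfl
  have hs : S * S = f' (w * w) := by
    rw [hf' (by simp [hw])]
    exact hsq _ rfl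
  have hodd {x : Γ} (hx : π x = -1) : π (x * w⁻¹) = 1 := by simp [hx, hw]
  refine ⟨⟨⟨fun x => if π x = 1 then f' x else f' (x * w⁻¹) * S, ?_⟩, fun x y => ?_⟩, fun g => ?_⟩
  · simp only [map_one, if_true]
    rw [hf' (map_one π)]
    exact map_one f
  · rcases Int.units_eq_one_or (π x) with hx | hx <;>
      rcases Int.units_eq_one_or (π y) with hy | hy
    · simp [hx, hy, hmul hx hy]
    · simp [hx, hy, mul_assoc x, hmul hx (hodd hy), mul_assoc]
    · have key : f' (x * y * w⁻¹) * S = f' (x * w⁻¹) * S * f' y := by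
        rw [mul_assoc (f' _), hc hy, ← mul_assoc (f' _), ← hmul (hodd hx) (by simp [hy])]
        congr 2
        group
      simpa [hx, hy] using key
    · have h2 : π (w * (y * w⁻¹) * w⁻¹) = 1 := by simp [hy, hw]
      have h3 : π (w * w) = 1 := by simp [hw]
      have key : f' (x * y) = f' (x * w⁻¹) * S * (f' (y * w⁻¹) * S) := by
        rw [mul_assoc, ← mul_assoc S, hc (hodd hy), mul_assoc, hs, ← hmul h2 h3,
          ← hmul (hodd hx) (by simp [hy, hw])]
        congr 1
        group
      simpa [hx, hy] using key
  · have hg : π g = 1 := g.2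
    simp [hg, hf' hg]

/-- The forms `B_w(u, v) = ⟨u, w⁻¹ v⟩` of a unitary representation of the whole graded group. -/
theorem isHRep_inner {Γ : Type} [Group Γ] (π : Γ →* ℤˣ)
    {V : Type} [NormedAddCommGroup V] [InnerProductSpace ℂ V]
    (σ : Representation ℂ Γ V) (hσ : ∀ (x : Γ) (u v : V), inner ℂ (σ x u) (σ x v) = inner ℂ u v)
    (ρ : Representation ℂ π.ker V) (hρ : ∀ (g : π.ker) (v : V), σ (g : Γ) v = ρ g v) :
    IsHRep π ρ fun w u v => inner ℂ u (σ w⁻¹ v) where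
  add_left _ _ u u' v := inner_add_left _ _ _
  smul_left _ _ a u v := inner_smul_left _ _ _
  add_right _ _ u v v' := by rw [map_add, inner_add_right]
  smul_right _ _ a u v := by rw [map_smul, inner_smul_right]
  nondeg_left w _ u h := by
    have := h (σ w u)
    rwa [σ.inv_self_apply, inner_self_eq_zero] at this
  nondeg_right w _ v h := by
    have := h (σ w⁻¹ v)
    rw [inner_self_eq_zero] at this
    rw [← σ.self_inv_apply w v, this, map_zero]
  invariant w _ g u v := by
    rw [← hρ, ← hρ, ← Module.End.mul_apply, ← map_mul]
    have : w⁻¹ * (conjKer π w g : Γ) = g * w⁻¹ := by simp [conjKer, mul_assoc]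
    rw [this, map_mul, Module.End.mul_apply, hσ]
  hermitian w _ u v := by
    rw [← hρ, ← Module.End.mul_apply, ← map_mul]
    have : w⁻¹ * (sqKer π w : Γ) = w := by simp [sqKer]
    rw [this, inner_conj_symm, ← hσ w⁻¹, σ.inv_self_apply]
  compat w₁ w₂ h₁ h₂ u v := by
    rw [← hρ, ← Module.End.mul_apply, ← map_mul]
    have : w₂⁻¹ * (ratioKer π w₂ w₁ h₂ h₁ : Γ) = w₁⁻¹ := by simp [ratioKer]
    rw [this]

/-- A sesquilinear form on a finite-dimensional inner product space is represented by an
endomorphism. -/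
theorem exists_end_inner_eq {V : Type*} [NormedAddCommGroup V] [InnerProductSpace ℂ V]
    [FiniteDimensional ℂ V] (B : V →ₗ⋆[ℂ] V →ₗ[ℂ] ℂ) :
    ∃ A : Module.End ℂ V, ∀ u v, inner ℂ (A u) v = B u v := by
  have := FiniteDimensional.complete ℂ V
  have hA (u v : V) : inner ℂ ((InnerProductSpace.toDual ℂ V).symm
      (LinearMap.toContinuousLinearMap (B u))) v = B u v := by
    rw [InnerProductSpace.toDual_symm_apply, LinearMap.coe_toContinuousLinearMap']
  refine ⟨⟨⟨fun u => (InnerProductSpace.toDual ℂ V).symm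
    (LinearMap.toContinuousLinearMap (B u)), fun u u' => ?_⟩, fun a u => ?_⟩, hA⟩ <;> simp [map_smulₛₗ]

/-- An `H`-representation whose even part is unitary extends linearly to the whole group. -/
theorem IsHermRep.exists_extension_of_unitary {Γ : Type} [Group Γ] {π : Γ →* ℤˣ}
    (hπ : Function.Surjective π)
    {V : Type} [NormedAddCommGroup V] [InnerProductSpace ℂ V] [FiniteDimensional ℂ V]
    {ρ : Representation ℂ π.ker V}
    (hρ : ∀ (g : π.ker) (u v : V), inner ℂ (ρ g u) (ρ g v) = inner ℂ u v)
    {B : Γ → V → V → ℂ} (hB : IsHRep π ρ B) :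
    ∃ σ : Representation ℂ Γ V, ∀ (g : π.ker) (v : V), σ (g : Γ) v = ρ g v := by
  obtain ⟨w, hw⟩ := hπ (-1)
  obtain ⟨A, hA⟩ := exists_end_inner_eq (LinearMap.mk₂'ₛₗ (starRingEnd ℂ) (RingHom.id ℂ) (B w)
    (hB.add_left w hw) (hB.smul_left w hw) (hB.add_right w hw) (hB.smul_right w hw))
  simp only [LinearMap.mk₂'ₛₗ_apply] at hA
  have hA0 : Function.Injective A := by
    refine (injective_iff_map_eq_zero A).2 fun u hu => hB.nondeg_left w hw u fun v => ?_
    rw [← hA, hu, inner_zero_left]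
  have hconj (g : π.ker) : A * ρ g = ρ (conjKer π w g) * A := by
    ext u
    refine ext_inner_right ℂ fun v => ?_
    have h := hB.invariant w hw g u (ρ (conjKer π w g)⁻¹ v)
    rw [ρ.self_inv_apply] at h
    rw [Module.End.mul_apply, hA, h, ← hA, ← hρ (conjKer π w g), ρ.self_inv_apply,
      Module.End.mul_apply]
  have hherm (u v : V) : inner ℂ (ρ (sqKer π w)⁻¹ (A u)) v = inner ℂ u (A v) := by
    rw [← hρ (sqKer π w), ρ.self_inv_apply, hA, hB.hermitian w hw, ← hA, inner_conj_symm]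
  have hsqinv : A * ρ (sqKer π w)⁻¹ = ρ (sqKer π w)⁻¹ * A := by
    rw [hconj]
    congr 2
    ext
    simp [conjKer, sqKer]
  let P : Module.End ℂ V := ρ (sqKer π w)⁻¹ * A * A
  have hP : P.IsSymmetric := fun u v => by
    simp only [P, Module.End.mul_apply]
    rw [hherm, ← inner_conj_symm u, hherm, inner_conj_symm]
  have hinj : Function.Injective P :=
    (ρ.apply_bijective _).1.comp (hA0.comp hA0)
  obtain ⟨Q, hQ, hcomm⟩ := hP.exists_inverse_sqrt hinj
  have hQA : A * Q = Q * A := hcomm A <| by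
    simp only [P, Commute, SemiconjBy, ← mul_assoc, hsqinv]
  have hQρ (g : π.ker) : ρ g * Q = Q * ρ g := hcomm (ρ g) <| by
    have h1 : (sqKer π w)⁻¹ * conjKer π w (conjKer π w g) = g * (sqKer π w)⁻¹ := by
      ext
      simp [conjKer, sqKer, mul_assoc]
    calc ρ g * P = ρ (g * (sqKer π w)⁻¹) * A * A := by simp only [P, map_mul, mul_assoc]
      _ = ρ (sqKer π w)⁻¹ * (ρ (conjKer π w (conjKer π w g)) * A) * A := by
        rw [← h1, map_mul, mul_assoc (ρ _)]
      _ = P * ρ g := by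
        rw [← hconj]
        simp only [P, mul_assoc, hconj g]
  have hS : A * Q * (A * Q) = ρ (sqKer π w) := by
    have h2 : A * A = ρ (sqKer π w) * P := by
      simp only [P, ← mul_assoc, ← map_mul]
      simp
    have h3 : P * (Q * Q) = 1 := by
      have hc : Commute P Q := hcomm P (Commute.refl P)
      rw [(hc.mul_right hc).eq, hQ]
    rw [mul_assoc, ← mul_assoc Q, ← hQA, mul_assoc A, ← mul_assoc, h2, mul_assoc, h3, mul_one]
  obtain ⟨F, hF⟩ := exists_monoidHom_extending_ker π ρ w hw (A * Q)
    (fun g g' h => by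
      obtain rfl : g' = conjKer π w g := Subtype.ext h
      rw [mul_assoc, ← hQρ, ← mul_assoc, hconj, mul_assoc])
    (fun g h => by
      obtain rfl : g = sqKer π w := Subtype.ext h
      exact hS)
  exact ⟨F, fun g v => by rw [hF]⟩

/-- A `ℂG`-module extends to a `ℂ`-linear representation of the whole graded group `Ghat` if and
only if it carries a family of forms making it an `H`-representation. -/
theorem extends_linear_iff_extends_H
    {Ghat : Type} [Group Ghat] [Finite Ghat] (π : Ghat →* ℤˣ)
    (hπ : Function.Surjective π)
    {V : Type} [AddCommGroup V] [Module ℂ V] [FiniteDimensional ℂ V]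
    (ρ : Representation ℂ π.ker V) :
    (∃ ρh : Representation ℂ Ghat V, ∀ (g : π.ker) (v : V), ρh (g : Ghat) v = ρ g v) ↔
    (∃ B : Ghat → V → V → ℂ, IsHRep π ρ B) := by
  constructor
  · rintro ⟨σ, hσ⟩
    obtain ⟨c, hc⟩ := σ.exists_invariant_innerProductSpaceCore
    let : NormedAddCommGroup V := c.toNormedAddCommGroup
    let : InnerProductSpace ℂ V := InnerProductSpace.ofCore c.toCore
    exact ⟨_, isHRep_inner π σ hc ρ hσ⟩
  · rintro ⟨B, hB⟩
    obtain ⟨c, hc⟩ := ρ.exists_invariant_innerProductSpaceCore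
    let : NormedAddCommGroup V := c.toNormedAddCommGroup
    let : InnerProductSpace ℂ V := InnerProductSpace.ofCore c.toCore
    exact IsHermRep.exists_extension_of_unitary hπ hc hB
end

section
/- Let (Ĝ, π) be a C₂-graded finite group with G = ker π, let W be a simple finite-dimensional complex representation of G, let w ∈ Ĝ \ G be an odd element, and let B : W × W → ℂ be a nondegenerate bilinear form satisfying B(g·u, (wgw⁻¹)·v) = B(u, v) for all g ∈ G and u, v ∈ W. Then there exists λ ∈ {1, −1} such that B(u, w²·v) = λ·B(v, u) for all u, v ∈ W. -/
open scoped ComplexConjugate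

/-- On a simple `ℂG`-module, a nondegenerate `w`-invariant bilinear form `B` satisfies
`B(u, w²·v) = λ·B(v, u)` for a sign `λ ∈ {1, -1}`. -/
theorem bilinear_invariant_form_sign
    {Ghat : Type} [Group Ghat] [Finite Ghat] (π : Ghat →* ℤˣ)
    (hπ : Function.Surjective π)
    {W : Type} [AddCommGroup W] [Module ℂ W] [FiniteDimensional ℂ W]
    (ρ : Representation ℂ π.ker W)
    (hsimple : IsSimpleGSub ℂ π ρ (⊤ : Submodule ℂ W))
    (w : Ghat) (hw : π w = -1)
    (B : W → W → ℂ)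
    (h_add_left : ∀ u u' v : W, B (u + u') v = B u v + B u' v)
    (h_smul_left : ∀ (c : ℂ) (u v : W), B (c • u) v = c * B u v)
    (h_add_right : ∀ u v v' : W, B u (v + v') = B u v + B u v')
    (h_smul_right : ∀ (c : ℂ) (u v : W), B u (c • v) = c * B u v)
    (h_nondeg_left : ∀ u : W, (∀ v : W, B u v = 0) → u = 0)
    (h_nondeg_right : ∀ v : W, (∀ u : W, B u v = 0) → v = 0)
    (h_inv : ∀ (g : π.ker) (u v : W), B (ρ g u) (ρ (conjKer π w g) v) = B u v) :
    ∃ lam : ℂ, (lam = 1 ∨ lam = -1) ∧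
      ∀ u v : W, B u (ρ (sqKer π w) v) = lam * B v u := by
  let β : LinearMap.BilinForm ℂ W :=
    LinearMap.mk₂ ℂ B h_add_left h_smul_left h_add_right h_smul_right
  have hβ : β.Nondegenerate := ⟨h_nondeg_left, h_nondeg_right⟩
  let γ : LinearMap.BilinForm ℂ W := β.flip.comp (ρ (sqKer π w)) LinearMap.id
  let T : Module.End ℂ W := γ.symmCompOfNondegenerate β hβ
  have hT (a b : W) : B (T a) b = B b (ρ (sqKer π w) a) :=
    LinearMap.congr_fun (γ.comp_symmCompOfNondegenerate_apply hβ a) b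
  have hγ (g : π.ker) (a b : W) :
      B (ρ (conjKer π w g) b) (ρ (sqKer π w) (ρ g a)) = B b (ρ (sqKer π w) a) := by
    have hcomm : sqKer π w * g = conjKer π w (conjKer π w g) * sqKer π w := by
      apply Subtype.ext
      simp [sqKer, conjKer, mul_assoc]
    rw [← Module.End.mul_apply, ← map_mul, hcomm, map_mul, Module.End.mul_apply, h_inv]
  have hT_comm (g : π.ker) (a : W) : T (ρ g a) = ρ g (T a) := by
    refine sub_eq_zero.mp (h_nondeg_left _ fun b => ?_)
    obtain ⟨c, rfl⟩ : ∃ c, ρ (conjKer π w g) c = b :=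
      ⟨ρ (conjKer π w g)⁻¹ b, ρ.self_inv_apply _ b⟩
    change β (T (ρ g a) - ρ g (T a)) _ = 0
    rw [map_sub, LinearMap.sub_apply, sub_eq_zero]
    change B _ _ = B _ _
    rw [hT, hγ, h_inv, hT]
  obtain ⟨-, htop, hmin⟩ := hsimple
  have : Nontrivial W := Submodule.nontrivial_iff ℂ |>.mp ⟨⊤, ⊥, htop⟩
  obtain ⟨lam, hlam⟩ := Module.End.exists_eigenvalue T
  have heig : T.eigenspace lam = ⊤ := by
    refine (hmin _ le_top fun g v hv => ?_).resolve_left hlam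
    rw [Module.End.mem_eigenspace_iff] at hv ⊢
    rw [hT_comm, hv, map_smul]
  have key (u v : W) : B u (ρ (sqKer π w) v) = lam * B v u := by
    have hv : T v = lam • v :=
      Module.End.mem_eigenspace_iff.mp (heig ▸ Submodule.mem_top)
    rw [← hT, hv, h_smul_left]
  refine ⟨lam, ?_, key⟩
  obtain ⟨v, hv⟩ := exists_ne (0 : W)
  obtain ⟨u, hu⟩ : ∃ u, B v u ≠ 0 := by
    by_contra! h
    exact hv (h_nondeg_left v h)
  have hconj : conjKer π w (sqKer π w) = sqKer π w := by
    apply Subtype.ext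
    simp [sqKer, conjKer, mul_assoc]
  have hinv := h_inv (sqKer π w) v u
  rw [hconj, key, key, ← mul_assoc] at hinv
  exact mul_self_eq_one_iff.mp (mul_right_cancel₀ hu (hinv.trans (one_mul _).symm))
end
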